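/- arXiv:1205.4133 — 7 statements merged into one kernel-verified Lean document; each statement's English description precedes it below -/
import Mathlib

section
/- Let a, n, l be positive integers, Ω₀ ∈ ℝ^{a×n}, X₀, Y ∈ ℝ^{n×l}, λ > 0, and let Λ̄ be the cosupport of Ω₀X₀. Then (Δ, Σ) = (0, 0) is the unique minimizer of L_λ(Δ, Σ) over T_C(Ω₀) × ℝ^{n×l} if and only if for every nonzero pair (Δ, Σ) ∈ T_C(Ω₀) × ℝ^{n×l} one has ‖(ΔX₀ + Ω₀Σ)_Λ̄‖₁ > |⟨ΔX₀ + Ω₀Σ, sgn(Ω₀X₀)⟩ + λ·tr(Σᵀ(X₀ − Y))|. -/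
open scoped BigOperators Classical
open Matrix

/-- Entrywise ℓ1 norm of a real matrix. -/
noncomputable def l1 {m n : ℕ} (A : Matrix (Fin m) (Fin n) ℝ) : ℝ :=
  ∑ i, ∑ j, |A i j|

/-- Frobenius norm of a real matrix. -/
noncomputable def frob {m n : ℕ} (A : Matrix (Fin m) (Fin n) ℝ) : ℝ :=
  Real.sqrt (∑ i, ∑ j, (A i j) ^ 2)

/-- Frobenius inner product ⟨A,B⟩ = tr(AᵀB). -/
noncomputable def finner {m n : ℕ} (A B : Matrix (Fin m) (Fin n) ℝ) : ℝ :=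
  ∑ i, ∑ j, A i j * B i j

/-- Entrywise sign matrix (with sgn 0 = 0). -/
noncomputable def msgn {m n : ℕ} (A : Matrix (Fin m) (Fin n) ℝ) : Matrix (Fin m) (Fin n) ℝ :=
  fun i j => Real.sign (A i j)

/-- Restriction A_Λ of a matrix to an index set Λ (zero outside Λ). -/
noncomputable def restrict {m n : ℕ} (A : Matrix (Fin m) (Fin n) ℝ)
    (Λ : Set (Fin m × Fin n)) : Matrix (Fin m) (Fin n) ℝ :=
  fun i j => if (i, j) ∈ Λ then A i j else 0

/-- Support of a matrix. -/
def suppSet {m n : ℕ} (M : Matrix (Fin m) (Fin n) ℝ) : Set (Fin m × Fin n) :=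
  {p | M p.1 p.2 ≠ 0}

/-- Cosupport of a matrix. -/
def cosuppSet {m n : ℕ} (M : Matrix (Fin m) (Fin n) ℝ) : Set (Fin m × Fin n) :=
  {p | M p.1 p.2 = 0}

/-- Euclidean norm of the i-th row of a matrix. -/
noncomputable def rowNorm {m n : ℕ} (A : Matrix (Fin m) (Fin n) ℝ) (i : Fin m) : ℝ :=
  Real.sqrt (∑ j, (A i j) ^ 2)

/-- Uniformly normalised tight frames with row norm c. -/
def untf (m n : ℕ) (c : ℝ) : Set (Matrix (Fin m) (Fin n) ℝ) :=
  {Ω | Ωᵀ * Ω = 1 ∧ ∀ i, rowNorm Ω i = c}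

/-- Tangent space T_C(Ω₀) of the UNTF constraint set at Ω₀. -/
def tangentC {m n : ℕ} (Ω₀ : Matrix (Fin m) (Fin n) ℝ) : Set (Matrix (Fin m) (Fin n) ℝ) :=
  {Δ | Δᵀ * Ω₀ + Ω₀ᵀ * Δ = 0 ∧ ∀ i, ∑ j, Ω₀ i j * Δ i j = 0}

/-- The linearised objective L_λ(Δ, Σ). -/
noncomputable def Lfun {a n l : ℕ} (Ω₀ : Matrix (Fin a) (Fin n) ℝ)
    (X₀ Y : Matrix (Fin n) (Fin l) ℝ) (lam : ℝ)
    (Δ : Matrix (Fin a) (Fin n) ℝ) (S : Matrix (Fin n) (Fin l) ℝ) : ℝ :=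
  l1 (Ω₀ * X₀ + Δ * X₀ + Ω₀ * S) + lam * Matrix.trace (Sᵀ * (X₀ - Y))

lemma aux_entry_le (m b : ℝ) :
    |m| + (b * Real.sign m + |if m = 0 then b else 0|) ≤ |m + b| := by
  rcases lt_trichotomy m 0 with h | h | h
  · rw [Real.sign_of_neg h, if_neg h.ne, abs_of_neg h]
    have := neg_abs_le (m + b)
    simp only [abs_zero]
    linarith
  · subst h; simp
  · rw [Real.sign_of_pos h, if_neg h.ne', abs_of_pos h]
    have := le_abs_self (m + b)
    simp only [abs_zero]
    linarith

lemma aux_entry_ev (m b : ℝ) : ∀ᶠ t in nhdsWithin (0 : ℝ) (Set.Ioi 0),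
    |m + t * b| = |m| + t * (b * Real.sign m + |if m = 0 then b else 0|) := by
  have hc : Filter.Tendsto (fun t : ℝ => m + t * b) (nhdsWithin 0 (Set.Ioi 0)) (nhds m) := by
    have h : Continuous (fun t : ℝ => m + t * b) := by fun_prop
    have := h.tendsto 0
    simp only [zero_mul, add_zero] at this
    exact this.mono_left nhdsWithin_le_nhds
  rcases lt_trichotomy m 0 with h | h | h
  · filter_upwards [hc.eventually (gt_mem_nhds h)] with t ht
    rw [Real.sign_of_neg h, if_neg h.ne, abs_of_neg h, abs_of_neg ht]
    simp only [abs_zero]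
    ring
  · subst h
    filter_upwards [self_mem_nhdsWithin] with t ht
    have ht : 0 < t := ht
    simp [abs_mul, abs_of_pos ht]
  · filter_upwards [hc.eventually (lt_mem_nhds h)] with t ht
    rw [Real.sign_of_pos h, if_neg h.ne', abs_of_pos h, abs_of_pos ht]
    simp only [abs_zero]
    ring

lemma aux_sum {m n : ℕ} (M B : Matrix (Fin m) (Fin n) ℝ) (t : ℝ) :
    l1 M + t * (finner B (msgn M) + l1 (restrict B (cosuppSet M))) =
    ∑ i, ∑ j, (|M i j| + t * (B i j * Real.sign (M i j) + |if M i j = 0 then B i j else 0|)) := by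
  simp only [l1, finner, msgn, restrict, cosuppSet, Set.mem_setOf_eq, Finset.sum_add_distrib,
    Finset.mul_sum, mul_add]

lemma aux_le {m n : ℕ} (M B : Matrix (Fin m) (Fin n) ℝ) :
    l1 M + (finner B (msgn M) + l1 (restrict B (cosuppSet M))) ≤ l1 (M + B) := by
  have := aux_sum M B 1
  simp only [one_mul] at this
  rw [this]
  exact Finset.sum_le_sum fun i _ => Finset.sum_le_sum fun j _ => aux_entry_le _ _

lemma aux_ex {m n : ℕ} (M B : Matrix (Fin m) (Fin n) ℝ) : ∃ t : ℝ, 0 < t ∧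
    l1 (M + t • B) = l1 M + t * (finner B (msgn M) + l1 (restrict B (cosuppSet M))) := by
  have h : ∀ᶠ t in nhdsWithin (0 : ℝ) (Set.Ioi 0), ∀ i j, |M i j + t * B i j| =
      |M i j| + t * (B i j * Real.sign (M i j) + |if M i j = 0 then B i j else 0|) :=
    Filter.eventually_all.2 fun i => Filter.eventually_all.2 fun j => aux_entry_ev _ _
  obtain ⟨t, ht, ht0⟩ := (h.and self_mem_nhdsWithin).exists
  refine ⟨t, ht0, ?_⟩
  rw [aux_sum]
  exact Finset.sum_congr rfl fun i _ => Finset.sum_congr rfl fun j _ => ht i j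

lemma aux_smul {m n : ℕ} (Ω₀ D : Matrix (Fin m) (Fin n) ℝ) (t : ℝ) (h : D ∈ tangentC Ω₀) :
    t • D ∈ tangentC Ω₀ := by
  refine ⟨?_, fun i => ?_⟩
  · rw [Matrix.transpose_smul, Matrix.smul_mul, Matrix.mul_smul, ← smul_add, h.1, smul_zero]
  · have := h.2 i
    simp only [Matrix.smul_apply, smul_eq_mul, mul_left_comm _ t, ← Finset.mul_sum, this, mul_zero]

lemma aux_pos {a n l : ℕ} (lam : ℝ)
    (Ω₀ : Matrix (Fin a) (Fin n) ℝ) (X₀ Y : Matrix (Fin n) (Fin l) ℝ)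
    (H : ∀ Δ ∈ tangentC Ω₀, ∀ S : Matrix (Fin n) (Fin l) ℝ, (Δ, S) ≠ (0, 0) →
        Lfun Ω₀ X₀ Y lam 0 0 < Lfun Ω₀ X₀ Y lam Δ S)
    (D : Matrix (Fin a) (Fin n) ℝ) (hD : D ∈ tangentC Ω₀) (S : Matrix (Fin n) (Fin l) ℝ)
    (hne : (D, S) ≠ (0, 0)) :
    0 < finner (D * X₀ + Ω₀ * S) (msgn (Ω₀ * X₀)) + lam * Matrix.trace (Sᵀ * (X₀ - Y)) +
          l1 (restrict (D * X₀ + Ω₀ * S) (cosuppSet (Ω₀ * X₀))) := by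
  obtain ⟨t, ht, e⟩ := aux_ex (Ω₀ * X₀) (D * X₀ + Ω₀ * S)
  have h := H (t • D) (aux_smul _ _ _ hD) (t • S) (by
    intro h
    apply hne
    simp only [Prod.mk.injEq, smul_eq_zero, ht.ne', false_or] at h
    rw [h.1, h.2])
  have e2 : Ω₀ * X₀ + (t • D) * X₀ + Ω₀ * (t • S) = Ω₀ * X₀ + t • (D * X₀ + Ω₀ * S) := by
    rw [Matrix.smul_mul, Matrix.mul_smul, smul_add, add_assoc]
  simp only [Lfun] at h
  rw [e2, e] at h
  simp only [Matrix.transpose_smul, Matrix.smul_mul, Matrix.trace_smul, smul_eq_mul,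
    Matrix.zero_mul, Matrix.mul_zero, add_zero, Matrix.transpose_zero, Matrix.trace_zero,
    mul_zero] at h
  refine pos_of_mul_pos_right (a := t) ?_ ht.le
  linarith

/-- (0,0) is the unique minimizer of L_λ over T_C(Ω₀) × ℝ^{n×l} iff for every
nonzero pair (Δ,Σ) one has ‖(ΔX₀+Ω₀Σ)_Λ̄‖₁ > |⟨ΔX₀+Ω₀Σ, sgn(Ω₀X₀)⟩ + λ·tr(Σᵀ(X₀−Y))|. -/
theorem stmt1 (a n l : ℕ) (ha : 0 < a) (hn : 0 < n) (hl : 0 < l)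
    (lam : ℝ) (hlam : 0 < lam)
    (Ω₀ : Matrix (Fin a) (Fin n) ℝ) (X₀ Y : Matrix (Fin n) (Fin l) ℝ) :
    (∀ Δ ∈ tangentC Ω₀, ∀ S : Matrix (Fin n) (Fin l) ℝ, (Δ, S) ≠ (0, 0) →
        Lfun Ω₀ X₀ Y lam 0 0 < Lfun Ω₀ X₀ Y lam Δ S) ↔
    (∀ Δ ∈ tangentC Ω₀, ∀ S : Matrix (Fin n) (Fin l) ℝ, (Δ, S) ≠ (0, 0) →
        |finner (Δ * X₀ + Ω₀ * S) (msgn (Ω₀ * X₀)) + lam * Matrix.trace (Sᵀ * (X₀ - Y))| <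
          l1 (restrict (Δ * X₀ + Ω₀ * S) (cosuppSet (Ω₀ * X₀)))) := by
  constructor
  · intro H D hD S hne
    have h1 := aux_pos lam Ω₀ X₀ Y H D hD S hne
    have h2 := aux_pos lam Ω₀ X₀ Y H (-D) (by simpa using aux_smul Ω₀ D (-1) hD) (-S) (by
      intro h
      apply hne
      simpa using h)
    have e : -D * X₀ + Ω₀ * -S = -(D * X₀ + Ω₀ * S) := by
      rw [Matrix.neg_mul, Matrix.mul_neg, neg_add]
    have e1 : ∀ B C : Matrix (Fin a) (Fin l) ℝ, finner (-B) C = - finner B C := by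
      intro B C; simp [finner]
    have e2 : ∀ (B : Matrix (Fin a) (Fin l) ℝ) C, l1 (restrict (-B) C) = l1 (restrict B C) := by
      intro B C
      refine Finset.sum_congr rfl fun i _ => Finset.sum_congr rfl fun j _ => ?_
      simp only [restrict]
      split_ifs <;> simp
    rw [e, e1, e2, Matrix.transpose_neg, Matrix.neg_mul, Matrix.trace_neg] at h2
    rw [abs_lt]
    constructor <;> linarith
  · intro H D hD S hne
    have h := (abs_lt.1 (H D hD S hne)).1
    have h2 := aux_le (Ω₀ * X₀) (D * X₀ + Ω₀ * S)
    simp only [Lfun, Matrix.zero_mul, Matrix.mul_zero, add_zero, Matrix.transpose_zero,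
      Matrix.trace_zero, mul_zero]
    rw [add_assoc (Ω₀ * X₀)]
    linarith
end

section
/- Let a, n, l be positive integers, Ω₀ ∈ ℝ^{a×n}, X ∈ ℝ^{n×l}, and let Λ̄ be the cosupport of Ω₀X. Then Δ = 0 is the unique minimizer of the convex function Δ ↦ ‖(Ω₀ + Δ)X‖₁ over the subspace T_C(Ω₀) if and only if for every nonzero Δ ∈ T_C(Ω₀) one has |⟨sgn(Ω₀X), ΔX⟩| < ‖(ΔX)_Λ̄‖₁. -/
open scoped BigOperators Classical
open Matrix

lemma aux_ge (m d : ℝ) :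
    |m| + (Real.sign m * d + |if m = 0 then d else 0|) ≤ |m + d| := by
  rcases lt_trichotomy m 0 with h | h | h
  · rw [Real.sign_of_neg h, if_neg h.ne, abs_of_neg h, abs_zero]
    linarith [neg_abs_le (m + d)]
  · subst h
    simp
  · rw [Real.sign_of_pos h, if_neg h.ne', abs_of_pos h, abs_zero]
    linarith [le_abs_self (m + d)]

lemma aux_eq (m d : ℝ) (h0 : m ≠ 0 → |d| ≤ |m|) :
    |m + d| = |m| + (Real.sign m * d + |if m = 0 then d else 0|) := by
  rcases lt_trichotomy m 0 with h | h | h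
  · have := h0 h.ne
    rw [abs_of_neg h] at this
    rw [Real.sign_of_neg h, if_neg h.ne, abs_of_neg h, abs_zero, abs_of_nonpos]
    · ring
    · linarith [le_abs_self d]
  · subst h
    simp
  · have := h0 h.ne'
    rw [abs_of_pos h] at this
    rw [Real.sign_of_pos h, if_neg h.ne', abs_of_pos h, abs_zero, abs_of_nonneg]
    · ring
    · linarith [neg_abs_le d]

lemma sum_form {p q : ℕ} (M D : Matrix (Fin p) (Fin q) ℝ) :
    l1 M + (finner (msgn M) D + l1 (restrict D (cosuppSet M))) =
      ∑ i, ∑ j, (|M i j| + (Real.sign (M i j) * D i j + |if M i j = 0 then D i j else 0|)) := by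
  simp only [l1, finner, msgn, restrict, cosuppSet, Set.mem_setOf_eq, Finset.sum_add_distrib]

lemma l1_ge {p q : ℕ} (M D : Matrix (Fin p) (Fin q) ℝ) :
    l1 M + (finner (msgn M) D + l1 (restrict D (cosuppSet M))) ≤ l1 (M + D) := by
  rw [sum_form]
  exact Finset.sum_le_sum fun i _ => Finset.sum_le_sum fun j _ => aux_ge _ _

lemma l1_eq {p q : ℕ} (M D : Matrix (Fin p) (Fin q) ℝ)
    (h : ∀ i j, M i j ≠ 0 → |D i j| ≤ |M i j|) :
    l1 (M + D) = l1 M + (finner (msgn M) D + l1 (restrict D (cosuppSet M))) := by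
  rw [sum_form]
  exact Finset.sum_congr rfl fun i _ => Finset.sum_congr rfl fun j _ => aux_eq _ _ (h i j)

lemma finner_smul {p q : ℕ} (t : ℝ) (A D : Matrix (Fin p) (Fin q) ℝ) :
    finner A (t • D) = t * finner A D := by
  simp only [finner, Matrix.smul_apply, smul_eq_mul, Finset.mul_sum]
  exact Finset.sum_congr rfl fun i _ => Finset.sum_congr rfl fun j _ => by ring

lemma l1_restrict_smul {p q : ℕ} (t : ℝ) (D : Matrix (Fin p) (Fin q) ℝ)
    (S : Set (Fin p × Fin q)) :
    l1 (restrict (t • D) S) = |t| * l1 (restrict D S) := by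
  simp only [l1, restrict, Matrix.smul_apply, smul_eq_mul, Finset.mul_sum]
  refine Finset.sum_congr rfl fun i _ => Finset.sum_congr rfl fun j _ => ?_
  split_ifs
  · rw [abs_mul]
  · simp

lemma tangent_smul {p q : ℕ} (t : ℝ) (W D : Matrix (Fin p) (Fin q) ℝ)
    (h : D ∈ tangentC W) : t • D ∈ tangentC W := by
  obtain ⟨h1, h2⟩ := h
  refine ⟨?_, fun i => ?_⟩
  · rw [Matrix.transpose_smul, Matrix.smul_mul, Matrix.mul_smul, ← smul_add, h1, smul_zero]
  · have : ∑ j, W i j * (t • D) i j = t * ∑ j, W i j * D i j := by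
      rw [Finset.mul_sum]
      exact Finset.sum_congr rfl fun j _ => by simp only [Matrix.smul_apply, smul_eq_mul]; ring
    rw [this, h2, mul_zero]

lemma exists_small {p q : ℕ} (M D : Matrix (Fin p) (Fin q) ℝ) :
    ∃ t : ℝ, 0 < t ∧ ∀ i j, M i j ≠ 0 → t * |D i j| ≤ |M i j| := by
  have key : ∀ᶠ t : ℝ in nhdsWithin 0 (Set.Ioi 0),
      ∀ i j, M i j ≠ 0 → t * |D i j| ≤ |M i j| := by
    refine nhdsWithin_le_nhds ?_
    refine Filter.eventually_all.2 fun i => Filter.eventually_all.2 fun j => ?_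
    by_cases hm : M i j = 0
    · exact Filter.Eventually.of_forall fun t h => absurd hm h
    · have hc : Filter.Tendsto (fun t : ℝ => t * |D i j|) (nhds 0) (nhds (0 * |D i j|)) :=
        (continuous_id.mul continuous_const).tendsto 0
      rw [zero_mul] at hc
      filter_upwards [hc.eventually (gt_mem_nhds (abs_pos.2 hm))] with t ht _
      exact ht.le
  obtain ⟨t, h1, h2⟩ := (key.and self_mem_nhdsWithin).exists
  exact ⟨t, h2, h1⟩

/-- Δ = 0 is the unique minimizer of Δ ↦ ‖(Ω₀+Δ)X‖₁ over T_C(Ω₀) iff for every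
nonzero Δ ∈ T_C(Ω₀) one has |⟨sgn(Ω₀X), ΔX⟩| < ‖(ΔX)_Λ̄‖₁. -/
theorem stmt6 (a n l : ℕ) (ha : 0 < a) (hn : 0 < n) (hl : 0 < l)
    (Ω₀ : Matrix (Fin a) (Fin n) ℝ) (X : Matrix (Fin n) (Fin l) ℝ) :
    (∀ Δ ∈ tangentC Ω₀, Δ ≠ 0 → l1 ((Ω₀ + 0) * X) < l1 ((Ω₀ + Δ) * X)) ↔
    (∀ Δ ∈ tangentC Ω₀, Δ ≠ 0 →
        |finner (msgn (Ω₀ * X)) (Δ * X)| < l1 (restrict (Δ * X) (cosuppSet (Ω₀ * X)))) := by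
  constructor
  · intro H Δ hΔ hne
    obtain ⟨t, ht, hs⟩ := exists_small (Ω₀ * X) (Δ * X)
    have main : ∀ s : ℝ, |s| = t →
        0 < s * finner (msgn (Ω₀ * X)) (Δ * X)
          + t * l1 (restrict (Δ * X) (cosuppSet (Ω₀ * X))) := by
      intro s hst
      have hs0 : s ≠ 0 := by
        rintro rfl
        rw [abs_zero] at hst
        exact ht.ne hst
      have h1 := H (s • Δ) (tangent_smul s _ _ hΔ) (smul_ne_zero hs0 hne)
      rw [add_zero, Matrix.add_mul, Matrix.smul_mul, l1_eq, finner_smul, l1_restrict_smul,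
        hst] at h1
      · linarith
      · intro i j hm
        rw [Matrix.smul_apply, smul_eq_mul, abs_mul, hst]
        exact hs i j hm
    have h1 := main t (abs_of_pos ht)
    have h2 := main (-t) (by rw [abs_neg, abs_of_pos ht])
    rw [abs_lt]
    constructor
    · refine lt_of_mul_lt_mul_left ?_ ht.le
      linarith
    · refine lt_of_mul_lt_mul_left ?_ ht.le
      linarith
  · intro H Δ hΔ hne
    have h1 := (abs_lt.1 (H Δ hΔ hne)).1
    have h2 := l1_ge (Ω₀ * X) (Δ * X)
    rw [add_zero, Matrix.add_mul]
    linarith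
end

section
/- Let a, n, l be positive integers, Ω₀ ∈ ℝ^{a×n}, X ∈ ℝ^{n×l}, let Λ be the support of Ω₀X and Λ̄ its complement. If for every nonzero Δ ∈ T_C(Ω₀) one has ‖(ΔX)_Λ‖₁ < ‖(ΔX)_Λ̄‖₁, then Δ = 0 is the unique minimizer of the convex function Δ ↦ ‖(Ω₀ + Δ)X‖₁ over the subspace T_C(Ω₀), i.e. Ω₀ is locally identifiable from the training matrix X. -/
open scoped BigOperators Classical
open Matrix

/-- if ‖(ΔX)_Λ‖₁ < ‖(ΔX)_Λ̄‖₁ for every nonzero Δ ∈ T_C(Ω₀), then Δ = 0 is the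
unique minimizer of Δ ↦ ‖(Ω₀+Δ)X‖₁ over T_C(Ω₀), i.e. Ω₀ is locally identifiable from X. -/
theorem stmt7 (a n l : ℕ) (ha : 0 < a) (hn : 0 < n) (hl : 0 < l)
    (Ω₀ : Matrix (Fin a) (Fin n) ℝ) (X : Matrix (Fin n) (Fin l) ℝ)
    (hsuff : ∀ Δ ∈ tangentC Ω₀, Δ ≠ 0 →
        l1 (restrict (Δ * X) (suppSet (Ω₀ * X))) <
          l1 (restrict (Δ * X) (cosuppSet (Ω₀ * X)))) :
    ∀ Δ ∈ tangentC Ω₀, Δ ≠ 0 → l1 ((Ω₀ + 0) * X) < l1 ((Ω₀ + Δ) * X) := by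
  intro Δ hΔ h0
  have h := hsuff Δ hΔ h0
  rw [add_zero, Matrix.add_mul]
  generalize Ω₀ * X = A at *
  generalize Δ * X = B at *
  have key : l1 A + l1 (restrict B (cosuppSet A)) ≤ l1 (A + B) + l1 (restrict B (suppSet A)) := by
    simp only [l1, ← Finset.sum_add_distrib]
    refine Finset.sum_le_sum fun i _ => Finset.sum_le_sum fun j _ => ?_
    by_cases hA : A i j = 0
    · simp [restrict, cosuppSet, suppSet, hA]
    · have h1 := abs_sub (A i j + B i j) (B i j)
      rw [add_sub_cancel_right] at h1
      simpa [restrict, cosuppSet, suppSet, hA] using h1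
  linarith
end

section
/- Let a, l be positive integers and Z, D ∈ ℝ^{a×l}, and let Λ̄ be the cosupport of Z. Then there exists t₀ > 0 such that for all t with 0 < t < t₀ one has ‖Z + tD‖₁ = ‖Z‖₁ + t·⟨D, sgn(Z)⟩ + t·‖D_Λ̄‖₁. -/
open scoped BigOperators Classical
open Matrix

open Filter Topology in
lemma abs_expand (z d : ℝ) : ∀ᶠ t in 𝓝[>] (0:ℝ),
    |z + t * d| = |z| + t * (d * Real.sign z) + t * |if z = 0 then d else 0| := by
  have hc : Tendsto (fun t : ℝ => z + t * d) (𝓝[>] 0) (𝓝 z) := by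
    have : ContinuousAt (fun t : ℝ => z + t * d) 0 := by fun_prop
    have h2 := this.tendsto
    simp only [zero_mul, add_zero] at h2
    exact h2.mono_left nhdsWithin_le_nhds
  rcases lt_trichotomy z 0 with h | h | h
  · filter_upwards [hc.eventually (gt_mem_nhds h)] with t ht
    rw [abs_of_neg ht, abs_of_neg h, Real.sign_of_neg h, if_neg h.ne]
    simp only [abs_zero]; ring
  · filter_upwards [self_mem_nhdsWithin] with t ht
    have ht' : 0 < t := ht
    simp [h, abs_mul, abs_of_pos ht']
  · filter_upwards [hc.eventually (lt_mem_nhds h)] with t ht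
    rw [abs_of_pos ht, abs_of_pos h, Real.sign_of_pos h, if_neg h.ne']
    simp only [abs_zero]; ring

/-- first-order expansion of the entrywise ℓ1 norm along a direction D. -/
theorem stmt8 (a l : ℕ) (ha : 0 < a) (hl : 0 < l)
    (Z D : Matrix (Fin a) (Fin l) ℝ) :
    ∃ t₀ > (0 : ℝ), ∀ t : ℝ, 0 < t → t < t₀ →
      l1 (Z + t • D) = l1 Z + t * finner D (msgn Z) + t * l1 (restrict D (cosuppSet Z)) := by
  have h : ∀ᶠ t in nhdsWithin (0:ℝ) (Set.Ioi 0), ∀ i j,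
      |Z i j + t * D i j| = |Z i j| + t * (D i j * Real.sign (Z i j))
        + t * |if Z i j = 0 then D i j else 0| :=
    Filter.eventually_all.2 fun i => Filter.eventually_all.2 fun j => abs_expand _ _
  obtain ⟨t₀, h0, hs⟩ := mem_nhdsGT_iff_exists_Ioo_subset.1 h
  refine ⟨t₀, h0, fun t ht1 ht2 => ?_⟩
  have hh := hs ⟨ht1, ht2⟩
  simp only [Set.mem_setOf_eq] at hh
  simp only [l1, finner, msgn, restrict, cosuppSet, Set.mem_setOf_eq, Matrix.add_apply,
    Matrix.smul_apply, smul_eq_mul, hh, Finset.sum_add_distrib, Finset.mul_sum]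
end

section
/- Let a, n, l be positive integers, Ω₀ ∈ ℝ^{a×n}, X₀, Y ∈ ℝ^{n×l}, λ > 0, and let Λ̄ be the cosupport of Ω₀X₀. For every Δ ∈ ℝ^{a×n} and Σ ∈ ℝ^{n×l} there exists t₀ > 0 such that for all t with 0 < t < t₀: L_λ(tΔ, tΣ) − L_λ(0, 0) = t·(⟨ΔX₀ + Ω₀Σ, sgn(Ω₀X₀)⟩ + ‖(ΔX₀ + Ω₀Σ)_Λ̄‖₁ + λ·tr(Σᵀ(X₀ − Y))). -/
open scoped BigOperators Classical
open Matrix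

lemma scalar_exp (m d : ℝ) : ∀ᶠ t in nhdsWithin (0:ℝ) (Set.Ioi 0),
    |m + t * d| - |m| = t * (d * Real.sign m + |if m = 0 then d else 0|) := by
  have hc : Filter.Tendsto (fun t : ℝ => m + t * d) (nhdsWithin (0:ℝ) (Set.Ioi 0)) (nhds m) := by
    have : Continuous (fun t : ℝ => m + t * d) := by fun_prop
    have h := this.tendsto 0
    simp only [zero_mul, add_zero] at h
    exact h.mono_left nhdsWithin_le_nhds
  rcases lt_trichotomy m 0 with h | h | h
  · filter_upwards [hc.eventually_lt_const h] with t ht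
    rw [abs_of_neg ht, abs_of_neg h, Real.sign_of_neg h, if_neg h.ne, abs_zero]
    ring
  · filter_upwards [self_mem_nhdsWithin] with t ht
    have ht' : 0 < t := ht
    subst h
    simp [abs_mul, abs_of_pos ht']
  · filter_upwards [hc.eventually_const_lt h] with t ht
    rw [abs_of_pos ht, abs_of_pos h, Real.sign_of_pos h, if_neg h.ne', abs_zero]
    ring

/-- first-order expansion of L_λ along the direction (Δ, Σ). -/
theorem stmt9 (a n l : ℕ) (ha : 0 < a) (hn : 0 < n) (hl : 0 < l)
    (lam : ℝ) (hlam : 0 < lam)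
    (Ω₀ : Matrix (Fin a) (Fin n) ℝ) (X₀ Y : Matrix (Fin n) (Fin l) ℝ)
    (Δ : Matrix (Fin a) (Fin n) ℝ) (S : Matrix (Fin n) (Fin l) ℝ) :
    ∃ t₀ > (0 : ℝ), ∀ t : ℝ, 0 < t → t < t₀ →
      Lfun Ω₀ X₀ Y lam (t • Δ) (t • S) - Lfun Ω₀ X₀ Y lam 0 0 =
        t * (finner (Δ * X₀ + Ω₀ * S) (msgn (Ω₀ * X₀)) +
             l1 (restrict (Δ * X₀ + Ω₀ * S) (cosuppSet (Ω₀ * X₀))) +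
             lam * Matrix.trace (Sᵀ * (X₀ - Y))) := by
  have key : ∀ᶠ t in nhdsWithin (0:ℝ) (Set.Ioi 0), ∀ i j,
      |(Ω₀ * X₀) i j + t * (Δ * X₀ + Ω₀ * S) i j| - |(Ω₀ * X₀) i j| =
        t * ((Δ * X₀ + Ω₀ * S) i j * Real.sign ((Ω₀ * X₀) i j) +
          |if (Ω₀ * X₀) i j = 0 then (Δ * X₀ + Ω₀ * S) i j else 0|) :=
    Filter.eventually_all.2 fun i => Filter.eventually_all.2 fun j => scalar_exp _ _
  obtain ⟨t₀, h0, hs⟩ := mem_nhdsGT_iff_exists_Ioo_subset.1 key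
  refine ⟨t₀, h0, fun t ht htt => ?_⟩
  have hk := hs ⟨ht, htt⟩
  simp only [Set.mem_setOf_eq] at hk
  have e : Ω₀ * X₀ + (t • Δ) * X₀ + Ω₀ * (t • S) = Ω₀ * X₀ + t • (Δ * X₀ + Ω₀ * S) := by
    rw [Matrix.smul_mul, Matrix.mul_smul, smul_add, add_assoc]
  have main : l1 (Ω₀ * X₀ + t • (Δ * X₀ + Ω₀ * S)) - l1 (Ω₀ * X₀) =
      t * (finner (Δ * X₀ + Ω₀ * S) (msgn (Ω₀ * X₀)) +
             l1 (restrict (Δ * X₀ + Ω₀ * S) (cosuppSet (Ω₀ * X₀)))) := by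
    unfold l1 finner msgn restrict cosuppSet
    simp only [← Finset.sum_sub_distrib, ← Finset.sum_add_distrib, Finset.mul_sum]
    refine Finset.sum_congr rfl fun i _ => Finset.sum_congr rfl fun j _ => ?_
    exact hk i j
  unfold Lfun
  rw [e]
  simp only [Matrix.zero_mul, Matrix.mul_zero, add_zero, Matrix.transpose_zero, Matrix.trace_zero,
    mul_zero, Matrix.transpose_smul, Matrix.smul_mul, Matrix.trace_smul, smul_eq_mul]
  linear_combination main
end

section
/- Let n, l, a be positive integers, c > 0, and X ∈ ℝ^{n×l}. Suppose ω* ∈ ℝⁿ satisfies ‖ω*‖₂ = c and ‖Xᵀω*‖₁ ≤ ‖Xᵀω‖₁ for every ω ∈ ℝⁿ with ‖ω‖₂ = c. Let Ω₁* ∈ ℝ^{a×n} be the matrix each of whose a rows equals ω*. Then ‖Ω₁* X‖₁ ≤ ‖ΩX‖₁ for every Ω ∈ ℝ^{a×n} all of whose rows have Euclidean norm c, and rank(Ω₁*) = 1. -/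
open scoped BigOperators Classical
open Matrix

/-- if ω* minimises ‖Xᵀω‖₁ over the sphere of radius c, then the matrix whose a
rows all equal ω* minimises ‖ΩX‖₁ over all matrices with rows of norm c, and it has rank 1. -/
theorem stmt12 (n l a : ℕ) (hn : 0 < n) (hl : 0 < l) (ha : 0 < a)
    (c : ℝ) (hc : 0 < c) (X : Matrix (Fin n) (Fin l) ℝ) (ωs : Fin n → ℝ)
    (hωs : Real.sqrt (∑ j, ωs j ^ 2) = c)
    (hmin : ∀ ω : Fin n → ℝ, Real.sqrt (∑ j, ω j ^ 2) = c →
        (∑ k, |Xᵀ.mulVec ωs k|) ≤ ∑ k, |Xᵀ.mulVec ω k|) :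
    (∀ Ω : Matrix (Fin a) (Fin n) ℝ, (∀ i, rowNorm Ω i = c) →
        l1 ((Matrix.of fun (_ : Fin a) (j : Fin n) => ωs j) * X) ≤ l1 (Ω * X)) ∧
      Matrix.rank (Matrix.of fun (_ : Fin a) (j : Fin n) => ωs j) = 1 := by
  have key : ∀ (Ω : Matrix (Fin a) (Fin n) ℝ) (i : Fin a) (k : Fin l),
      (Ω * X) i k = Xᵀ.mulVec (Ω i) k := by
    intro Ω i k
    simp only [Matrix.mul_apply, Matrix.mulVec, dotProduct, Matrix.transpose_apply]
    exact Finset.sum_congr rfl fun j _ => mul_comm _ _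
  refine ⟨?_, ?_⟩
  · intro Ω hΩ
    unfold l1
    refine Finset.sum_le_sum fun i _ => ?_
    simp only [key]
    exact hmin (Ω i) (hΩ i)
  · have hne : ωs ≠ 0 := by
      rintro rfl
      simp at hωs
      exact hc.ne hωs
    haveI : Nonempty (Fin a) := ⟨⟨0, ha⟩⟩
    rw [Matrix.rank_eq_finrank_span_row]
    have : Set.range (Matrix.of fun (_ : Fin a) (j : Fin n) => ωs j).row = {ωs} :=
      Set.range_const
    rw [this]
    exact finrank_span_singleton hne
end

section
/- Let n, l, a be positive integers with a ≥ n ≥ 2, c > 0, and X ∈ ℝ^{n×l}. Then the infimum of ‖ΩX‖₁ over all matrices Ω ∈ ℝ^{a×n} of rank n whose every row has Euclidean norm c equals a · min{‖Xᵀω‖₁ : ω ∈ ℝⁿ, ‖ω‖₂ = c}; in particular, adding the full-rank requirement to the row-norm constraint does not increase the optimal value, which is the value attained by the rank-one matrix whose rows all equal a minimizing ω. -/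
open scoped BigOperators Classical
open Matrix

/-- the infimum of ‖ΩX‖₁ over rank-n matrices with rows of norm c equals
a · min{‖Xᵀω‖₁ : ‖ω‖₂ = c}, the value attained by the rank-one matrix with rows ω*. -/
theorem stmt13 (n l a : ℕ) (hn2 : 2 ≤ n) (hna : n ≤ a) (hl : 0 < l)
    (c : ℝ) (hc : 0 < c) (X : Matrix (Fin n) (Fin l) ℝ) (ωs : Fin n → ℝ)
    (hωs : Real.sqrt (∑ j, ωs j ^ 2) = c)
    (hmin : ∀ ω : Fin n → ℝ, Real.sqrt (∑ j, ω j ^ 2) = c →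
        (∑ k, |Xᵀ.mulVec ωs k|) ≤ ∑ k, |Xᵀ.mulVec ω k|) :
    sInf {r : ℝ | ∃ Ω : Matrix (Fin a) (Fin n) ℝ,
        Matrix.rank Ω = n ∧ (∀ i, rowNorm Ω i = c) ∧ r = l1 (Ω * X)} =
      (a : ℝ) * ∑ k, |Xᵀ.mulVec ωs k| := by
  classical
  set M := ∑ k, |Xᵀ.mulVec ωs k| with hM
  have hl1 : ∀ Ω : Matrix (Fin a) (Fin n) ℝ, l1 (Ω * X) = ∑ i, ∑ k, |Xᵀ.mulVec (Ω i) k| := by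
    intro Ω
    unfold l1
    refine Finset.sum_congr rfl fun i _ => Finset.sum_congr rfl fun k _ => ?_
    congr 1
    simp only [Matrix.mul_apply, Matrix.mulVec, dotProduct, Matrix.transpose_apply]
    exact Finset.sum_congr rfl fun j _ => mul_comm _ _
  have hlow : ∀ r ∈ {r : ℝ | ∃ Ω : Matrix (Fin a) (Fin n) ℝ,
        Matrix.rank Ω = n ∧ (∀ i, rowNorm Ω i = c) ∧ r = l1 (Ω * X)}, (a : ℝ) * M ≤ r := by
    rintro r ⟨Ω, -, hr, rfl⟩
    rw [hl1]
    calc (a : ℝ) * M = ∑ _i : Fin a, M := by simp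
      _ ≤ _ := Finset.sum_le_sum fun i _ => hmin (Ω i) (hr i)
  let σ : Fin a → Fin n := fun i => if h : i.1 < n then ⟨i.1, h⟩ else ⟨0, by omega⟩
  have hσ : ∀ j : Fin n, ∃ i, σ i = j := fun j =>
    ⟨⟨j.1, lt_of_lt_of_le j.2 hna⟩, by simp [σ]⟩
  let R : ℝ → Fin a → Fin n → ℝ := fun t i j => ωs j + t * (if j = σ i then 1 else 0)
  let N : ℝ → Fin a → ℝ := fun t i => Real.sqrt (∑ j, (R t i j) ^ 2)
  let Ω : ℝ → Matrix (Fin a) (Fin n) ℝ := fun t i j => c / N t i * R t i j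
  have hR0 : ∀ i j, R 0 i j = ωs j := by intro i j; simp [R]
  have hN0 : ∀ i, N 0 i = c := by intro i; simp only [N, hR0]; exact hωs
  have hRc : ∀ i j, Continuous fun t => R t i j := by intro i j; simp only [R]; fun_prop
  have hNc : ∀ i, Continuous fun t => N t i := by
    intro i
    exact Real.continuous_sqrt.comp (continuous_finsetSum _ fun j _ => (hRc i j).pow 2)
  have hΩc : ∀ i j, ContinuousAt (fun t => Ω t i j) 0 := by
    intro i j
    refine ContinuousAt.mul (ContinuousAt.div continuousAt_const (hNc i).continuousAt ?_)
      (hRc i j).continuousAt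
    rw [hN0]; exact hc.ne'
  have hFc : ContinuousAt (fun t => l1 (Ω t * X)) 0 := by
    simp only [l1, Matrix.mul_apply]
    refine tendsto_finsetSum _ fun i _ => tendsto_finsetSum _ fun k _ => ?_
    refine Filter.Tendsto.abs ?_
    exact tendsto_finsetSum _ fun j _ => Filter.Tendsto.mul (hΩc i j) tendsto_const_nhds
  have hF0 : l1 (Ω 0 * X) = a * M := by
    rw [hl1]
    have : ∀ i, Ω 0 i = ωs := by
      intro i; ext j
      simp only [Ω, hR0, hN0]
      rw [div_self hc.ne', one_mul]
    simp only [this]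
    simp [hM]
  have hev : ∀ᶠ t in nhdsWithin (0 : ℝ) {0}ᶜ, t ≠ 0 ∧ t + ∑ j, ωs j ≠ 0 ∧ ∀ i, 0 < N t i := by
    refine Filter.Eventually.and self_mem_nhdsWithin (Filter.Eventually.and ?_ ?_)
    · by_cases h : ∑ j, ωs j = 0
      · rw [h]; simp only [add_zero]; exact self_mem_nhdsWithin
      · refine Filter.Eventually.filter_mono nhdsWithin_le_nhds ?_
        have : ContinuousAt (fun t : ℝ => t + ∑ j, ωs j) 0 := by fun_prop
        exact this.eventually_ne (by simpa using h)
    · refine Filter.Eventually.filter_mono nhdsWithin_le_nhds ?_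
      rw [Filter.eventually_all]
      intro i
      exact (hNc i).continuousAt.eventually (lt_mem_nhds (by beta_reduce; rw [hN0]; exact hc))
  have hmem : ∀ t : ℝ, (t ≠ 0 ∧ t + ∑ j, ωs j ≠ 0 ∧ ∀ i, 0 < N t i) →
      l1 (Ω t * X) ∈ {r : ℝ | ∃ Ω : Matrix (Fin a) (Fin n) ℝ,
        Matrix.rank Ω = n ∧ (∀ i, rowNorm Ω i = c) ∧ r = l1 (Ω * X)} := by
    rintro t ⟨ht, hts, hN⟩
    refine ⟨Ω t, ?_, ?_, rfl⟩
    · have hinj : Function.Injective (Ω t).mulVecLin := by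
        rw [← LinearMap.ker_eq_bot, LinearMap.ker_eq_bot']
        intro v hv
        have h1 : ∀ j, (∑ k, ωs k * v k) + t * v j = 0 := by
          intro j
          obtain ⟨i, rfl⟩ := hσ j
          have h2 : ∑ k, c / N t i * R t i k * v k = 0 := congrFun hv i
          have h3 : c / N t i * ∑ k, R t i k * v k = 0 := by
            rw [Finset.mul_sum, ← h2]
            exact Finset.sum_congr rfl fun k _ => by ring
          have h4 : ∑ k, R t i k * v k = 0 :=
            (mul_eq_zero.mp h3).resolve_left (div_pos hc (hN i)).ne'
          rw [← h4]
          simp [R, add_mul, Finset.sum_add_distrib]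
        set S := ∑ k, ωs k * v k with hS
        have h5 : (t + ∑ j, ωs j) * S = 0 := by
          have : ∑ j, ωs j * (S + t * v j) = 0 := by simp [h1]
          have h6 : ∑ j, ωs j * (S + t * v j) = (∑ j, ωs j) * S + t * S := by
            rw [Finset.sum_mul, hS, Finset.mul_sum, ← Finset.sum_add_distrib]
            exact Finset.sum_congr rfl fun k _ => by ring
          linarith
        have hS0 := (mul_eq_zero.mp h5).resolve_left hts
        ext j
        have := h1 j
        rw [hS0, zero_add] at this
        exact (mul_eq_zero.mp this).resolve_left ht
      unfold Matrix.rank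
      rw [LinearMap.finrank_range_of_inj hinj]
      simp
    · intro i
      have : ∑ j, (Ω t i j) ^ 2 = (c / N t i) ^ 2 * ∑ j, (R t i j) ^ 2 := by
        rw [Finset.mul_sum]
        exact Finset.sum_congr rfl fun k _ => by simp only [Ω]; ring
      unfold rowNorm
      rw [this, Real.sqrt_mul (sq_nonneg _), Real.sqrt_sq (div_pos hc (hN i)).le]
      exact div_mul_cancel₀ c (hN i).ne'
  apply le_antisymm
  · rw [← hF0]
    refine ge_of_tendsto (hFc.tendsto.mono_left (nhdsWithin_le_nhds (s := {0}ᶜ))) ?_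
    filter_upwards [hev] with t ht
    exact csInf_le ⟨_, hlow⟩ (hmem t ht)
  · obtain ⟨t, ht⟩ := hev.exists
    exact le_csInf ⟨_, hmem t ht⟩ hlow
end
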